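/- arXiv:1904.03073 — 2 statements merged into one kernel-verified Lean document; each statement's English description precedes it below -/
import Mathlib

section
/- (so(n−1)-Casimir identity on the exterior algebra.) Let n ≥ 2 and 0 ≤ p ≤ n. On Λ^p ℂ^n define L_{jk} := ε_{e_j} i_{e_k} − ε_{e_k} i_{e_j} for 1 ≤ j < k ≤ n−1. Then Σ_{1 ≤ j < k ≤ n−1} L_{jk}² = −p(n − p − 1) i_{e_n} ε_{e_n} − (p − 1)(n − p) ε_{e_n} i_{e_n} as linear operators on Λ^p ℂ^n. -/
open MeasureTheory Complex Finset

noncomputable section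

/-- Euclidean space ℝ^n -/
abbrev Rn (n : ℕ) := EuclideanSpace ℝ (Fin n)

/-- The full exterior algebra Λ^•ℂ^n, realized as the Euclidean space with orthonormal
basis indexed by subsets of {1,…,n} (the basis e_S = e_{i_1}∧…∧e_{i_p}). -/
abbrev Lam (n : ℕ) := EuclideanSpace ℂ (Finset (Fin n))

variable {n : ℕ}

/-- the sign (-1)^{#{i ∈ S : i < j}} -/
def wsign (j : Fin n) (S : Finset (Fin n)) : ℂ := (-1) ^ (S.filter (· < j)).card

/-- exterior multiplication ε_x by x ∈ ℂ^n -/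
def eps (x : Fin n → ℂ) (v : Lam n) : Lam n :=
  WithLp.toLp 2 fun S => ∑ j ∈ S, wsign j S * x j * v (S.erase j)

/-- interior multiplication i_x by x ∈ ℂ^n (adjoint of ε_x for real x) -/
def iot (x : Fin n → ℂ) (v : Lam n) : Lam n :=
  WithLp.toLp 2 fun S => ∑ j ∈ Sᶜ, wsign j S * x j * v (insert j S)

/-- v lies in the degree-p part Λ^p ℂ^n ⊆ Λ^• ℂ^n -/
def IsForm (p : ℕ) (v : Lam n) : Prop := ∀ S, S.card ≠ p → v S = 0

/-- complexification of a real vector -/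
def rc (x : Fin n → ℝ) : Fin n → ℂ := fun j => (x j : ℂ)

/-- the j-th standard basis vector of ℂ^n -/
def ee (j : Fin n) : Fin n → ℂ := fun i => if i = j then 1 else 0

/-- extend x' ∈ ℝ^{n-1} by last coordinate t to the vector (x',t) ∈ ℝ^n -/
def app (x' : Rn (n-1)) (t : ℝ) : Rn n :=
  WithLp.toLp 2 fun j => if h : (j : ℕ) < n - 1 then x' ⟨j, h⟩ else t

/-- restriction ℝ^n → ℝ^{n-1}, x ↦ x' -/
def restr (ξ : Rn n) : Rn (n-1) := WithLp.toLp 2 fun i => ξ (Fin.castLE (Nat.sub_le n 1) i)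

/-- the embedding Fin (n-1) ↪ Fin n -/
def embF : Fin (n-1) ↪ Fin n := ⟨Fin.castLE (Nat.sub_le n 1), (Fin.castLE_injective _)⟩

/-- pullback Λ^• ℂ^n → Λ^• ℂ^{n-1}; on p-forms this is the projection i_{e_n} ε_{e_n}
followed by restriction of indices. -/
def projL (v : Lam n) : Lam (n-1) := WithLp.toLp 2 fun T => v (T.map embF)

/-- the inclusion Λ^• ℂ^{n-1} ⊆ Λ^• ℂ^n -/
def incL (v : Lam (n-1)) : Lam n :=
  WithLp.toLp 2 fun S => ∑ T : Finset (Fin (n-1)), if T.map embF = S then v T else 0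

/-- the operator i_z ε_z - ε_z i_z -/
def cmm (z : Fin n → ℂ) (v : Lam n) : Lam n := iot z (eps z v) - eps z (iot z v)

/-- partial derivative ∂/∂x_j -/
def pd (j : Fin n) (u : Rn n → Lam n) : Rn n → Lam n :=
  fun x => fderiv ℝ u x (EuclideanSpace.single j 1)

/-- the differential operator Δ_{a,p} = x_n²Δ + a x_n ∂_n + 2x_n(i_{e_n}d' - ε_{e_n}δ')
- (n-2p) ε_{e_n} i_{e_n}; here ℓ is the index of the last coordinate. -/
def Dap (a : ℝ) (p : ℕ) (ℓ : Fin n) (u : Rn n → Lam n) (x : Rn n) : Lam n :=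
  ((x ℓ)^2 : ℝ) • (∑ j, pd j (pd j u) x)
  + (a * x ℓ) • pd ℓ u x
  + (2 * x ℓ) • (iot (ee ℓ) (∑ j ∈ univ.erase ℓ, eps (ee j) (pd j u x))
      - eps (ee ℓ) (-(∑ j ∈ univ.erase ℓ, iot (ee j) (pd j u x))))
  - ((n : ℝ) - 2*p) • eps (ee ℓ) (iot (ee ℓ) (u x))

/-- the formal transpose of Δ_{a,p} with respect to the bilinear pairing
∫ ⟨u(x), φ(x)⟩ dx (⟨·,·⟩ the bilinear form with ⟨e_S, e_T⟩ = δ_{ST}):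
Δ_{a,p}ᵗφ = Δ(x_n²φ) - a ∂_n(x_n φ) - 2x_n Σ_j (i_{e_j}ε_{e_n} + ε_{e_j}i_{e_n}) ∂_j φ
- (n-2p) ε_{e_n} i_{e_n} φ. -/
def DapT (a : ℝ) (p : ℕ) (ℓ : Fin n) (φ : Rn n → Lam n) (x : Rn n) : Lam n :=
  (∑ j, pd j (pd j (fun y => ((y ℓ)^2 : ℝ) • φ y)) x)
  - a • pd ℓ (fun y => (y ℓ) • φ y) x
  - (2 * x ℓ) • (∑ j ∈ univ.erase ℓ,
      (iot (ee j) (eps (ee ℓ) (pd j φ x)) + eps (ee j) (iot (ee ℓ) (pd j φ x))))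
  - ((n : ℝ) - 2*p) • eps (ee ℓ) (iot (ee ℓ) (φ x))

/-- the Fourier transform with the convention û(ξ) = (2π)^{-n/2} ∫ e^{-i x·ξ} u(x) dx -/
def ft (u : Rn n → Lam n) : Rn n → Lam n := fun ξ =>
  ((2 * Real.pi) ^ (-(n:ℝ)/2) : ℝ) •
    ∫ x, Complex.exp (-(((∑ j, x j * ξ j : ℝ) : ℂ) * Complex.I)) • u x

/-- the inverse Fourier transform -/
def ftInv (u : Rn n → Lam n) : Rn n → Lam n := fun ξ =>
  ((2 * Real.pi) ^ (-(n:ℝ)/2) : ℝ) •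
    ∫ x, Complex.exp ((((∑ j, x j * ξ j : ℝ) : ℂ) * Complex.I)) • u x

/-- The homogeneous Sobolev space Ḣ^{s,p}(ℝ^n) of Λ^pℂ^n-valued tempered distributions,
modeled on the Fourier transform side: an element of the set is the function g = û. -/
def Hdot (n : ℕ) (s : ℝ) (p : ℕ) : Set (Rn n → Lam n) :=
  {g | AEStronglyMeasurable g volume ∧ (∀ ξ, IsForm p (g ξ)) ∧
    Integrable (fun ξ => ‖ξ‖ ^ (2*s) * ‖g ξ‖^2)}

/-- squared weighted L² norm ∫ ‖ξ‖^t ‖g(ξ)‖² dξ on the Fourier side;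
wInt (2s) g is the squared homogeneous Sobolev norm of degree s of u with û = g. -/
def wInt (t : ℝ) (g : Rn n → Lam n) : ℝ := ∫ ξ, ‖ξ‖ ^ t * ‖g ξ‖^2

/-- the operator (c - λ) i_x ε_x + (c + λ) ε_x i_x on Λ^•ℂ^n -/
def opC (c lam : ℝ) (x : Fin n → ℝ) (v : Lam n) : Lam n :=
  ((c - lam : ℝ) : ℂ) • iot (rc x) (eps (rc x) v)
    + ((c + lam : ℝ) : ℂ) • eps (rc x) (iot (rc x) v)

/-- the conformally invariant squared norm ‖u‖_λ² on the Fourier side (for û = g);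
c is dim/2 - p, i.e. n/2 - p on ℝ^n and (n-1)/2 - p on ℝ^{n-1}. -/
def cSq (c lam : ℝ) (g : Rn n → Lam n) : ℝ :=
  ∫ ξ, ‖ξ‖ ^ (-(2*lam)) * (inner ℂ (g ξ) (opC c lam (‖ξ‖⁻¹ • ξ) (g ξ)) : ℂ).re

/-- the conformally invariant inner product on the Fourier side -/
def cIp (c lam : ℝ) (g h : Rn n → Lam n) : ℂ :=
  ∫ ξ, (‖ξ‖ ^ (-(2*lam)) : ℝ) • (inner ℂ (g ξ) (opC c lam (‖ξ‖⁻¹ • ξ) (h ξ)) : ℂ)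

/-- the bilinear pairing on Λ^•ℂ^n with ⟨e_S, e_T⟩ = δ_{ST} -/
def blin (v w : Lam n) : ℂ := ∑ S, v S * w S

/-- the pairing ⟨u, ψ⟩ of the tempered distribution u whose Fourier transform is g
with a Schwartz function ψ: ⟨u, ψ⟩ = ⟨û, 𝓕⁻¹ψ⟩ = ∫ ⟨g(ξ), (𝓕⁻¹ψ)(ξ)⟩ dξ. -/
def dpair (g : Rn n → Lam n) (ψ : Rn n → Lam n) : ℂ :=
  ∫ ξ, blin (g ξ) (ftInv ψ ξ)

/-- "Δ_{a,p} u = μ u in the sense of tempered distributions", expressed for the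
distribution u whose Fourier transform is g: testing against all Λ^•ℂ^n-valued
Schwartz functions φ via the formal transpose of Δ_{a,p}. -/
def WeakEig (a : ℝ) (p : ℕ) (ℓ : Fin n) (g : Rn n → Lam n) (μ : ℂ) : Prop :=
  ∀ φ : SchwartzMap (Rn n) (Lam n),
    dpair g (fun x => DapT a p ℓ (fun y => φ y) x - μ • φ x) = 0

/-- the Fourier side of the trace map u ↦ u|_{ℝ^{n-1}}:
(Ru)^(ξ') = (2π)^{-1/2} ∫_ℝ û(ξ', ξ_n) dξ_n, composed with the pullback
Λ^pℂ^n → Λ^pℂ^{n-1}. -/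
def ftrace (g : Rn n → Lam n) : Rn (n-1) → Lam (n-1) := fun ξ' =>
  ((2 * Real.pi) ^ (-(1:ℝ)/2) : ℝ) • ∫ t : ℝ, projL (g (app ξ' t))

/-- the constant c_{a,p} -/
def cP (n p : ℕ) (a : ℝ) : ℝ :=
  2 * Real.Gamma (((n:ℝ) - a + 2)/2) /
    (Real.pi ^ (((n:ℝ)-1)/2) * ((n:ℝ) - 2*p - a) * Real.Gamma ((1-a)/2))

/-- the Poisson transform P_{a,p}f(x) = c_{a,p} ∫_{ℝ^{n-1}} |x_n|^{1-a}
(|x'-y|²+x_n²)^{-(n-a+2)/2} (i_{x-y}ε_{x-y} - ε_{x-y}i_{x-y}) f(y) dy,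
where ℓ is the index of the last coordinate. -/
def Pois (a : ℝ) (p : ℕ) (ℓ : Fin n) (f : Rn (n-1) → Lam (n-1)) (x : Rn n) : Lam n :=
  cP n p a • ∫ y : Rn (n-1),
    (|x ℓ| ^ (1-a) * ‖x - app y 0‖ ^ (-((n:ℝ) - a + 2))) •
      cmm (rc (x - app y 0)) (incL (f y))

/-- "G is the Fourier transform of the (polynomially bounded, locally integrable)
function u in the sense of tempered distributions":
∫ ⟨G(ξ), ψ(ξ)⟩ dξ = ∫ ⟨u(x), ψ̂(x)⟩ dx for every Schwartz function ψ. -/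
def IsFTof (G : Rn n → Lam n) (u : Rn n → Lam n) : Prop :=
  ∀ ψ : SchwartzMap (Rn n) (Lam n),
    ∫ ξ, blin (G ξ) (ψ ξ) = ∫ x, blin (u x) (ft (fun y => ψ y) x)

/-- the operator L_{jk} = ε_{e_j} i_{e_k} - ε_{e_k} i_{e_j} on Λ^• ℂ^n -/
def Ljk {n : ℕ} (j k : Fin n) (v : Lam n) : Lam n :=
  eps (ee j) (iot (ee k) v) - eps (ee k) (iot (ee j) v)

lemma aux_eps (j : Fin n) (v : Lam n) (S : Finset (Fin n)) :
    eps (ee j) v S = if j ∈ S then wsign j S * v (S.erase j) else 0 := by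
  simp [eps, ee]

lemma aux_iot (j : Fin n) (v : Lam n) (S : Finset (Fin n)) :
    iot (ee j) v S = if j ∈ S then 0 else wsign j S * v (insert j S) := by
  simp [iot, ee]

lemma aux_sq (j : Fin n) (S : Finset (Fin n)) : wsign j S * wsign j S = 1 := by
  unfold wsign
  rw [← mul_pow]; simp

lemma aux_ins (j : Fin n) (S : Finset (Fin n)) : wsign j (insert j S) = wsign j S := by
  unfold wsign
  congr 2
  ext i
  simp only [Finset.mem_filter, Finset.mem_insert]
  constructor
  · rintro ⟨rfl | h, h'⟩
    · exact absurd h' (lt_irrefl _)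
    · exact ⟨h, h'⟩
  · rintro ⟨h, h'⟩
    exact ⟨Or.inr h, h'⟩

lemma aux_er (j : Fin n) (S : Finset (Fin n)) : wsign j (S.erase j) = wsign j S := by
  by_cases h : j ∈ S
  · conv_rhs => rw [← Finset.insert_erase h, aux_ins]
  · rw [Finset.erase_eq_of_notMem h]

lemma aux_ie (j : Fin n) (v : Lam n) (S : Finset (Fin n)) :
    iot (ee j) (eps (ee j) v) S = if j ∈ S then 0 else v S := by
  rw [aux_iot, aux_eps]
  by_cases h : j ∈ S
  · simp [h]
  · simp [h, aux_ins, ← mul_assoc, aux_sq]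

lemma aux_ei (j : Fin n) (v : Lam n) (S : Finset (Fin n)) :
    eps (ee j) (iot (ee j) v) S = if j ∈ S then v S else 0 := by
  rw [aux_eps, aux_iot]
  by_cases h : j ∈ S
  · simp [h, aux_er, ← mul_assoc, aux_sq]
  · simp [h]

lemma aux_L (j k : Fin n) (hjk : j ≠ k) (v : Lam n) (S : Finset (Fin n)) :
    Ljk j k v S =
      (if j ∈ S ∧ k ∉ S then wsign j S * (wsign k (S.erase j) * v (insert k (S.erase j))) else 0)
      - (if k ∈ S ∧ j ∉ S then wsign k S * (wsign j (S.erase k) * v (insert j (S.erase k)))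
          else 0) := by
  have h : Ljk j k v S = eps (ee j) (iot (ee k) v) S - eps (ee k) (iot (ee j) v) S := rfl
  rw [h, aux_eps, aux_eps, aux_iot, aux_iot]
  by_cases h1 : j ∈ S <;> by_cases h2 : k ∈ S <;> simp [h1, h2, hjk, hjk.symm]

lemma aux_sgn (j k : Fin n) (R : Finset (Fin n)) (x : ℂ) :
    wsign j R * (wsign k R * (wsign k R * (wsign j R * x))) = x := by
  linear_combination (wsign j R * wsign j R * x) * aux_sq k R + x * aux_sq j R

lemma aux_LL (j k : Fin n) (hjk : j ≠ k) (v : Lam n) (S : Finset (Fin n)) :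
    Ljk j k (Ljk j k v) S =
      -((if j ∈ S ∧ k ∉ S then 1 else 0) + (if k ∈ S ∧ j ∉ S then 1 else 0)) * v S := by
  rw [aux_L j k hjk, aux_L j k hjk, aux_L j k hjk]
  by_cases h1 : j ∈ S <;> by_cases h2 : k ∈ S
  · simp [h1, h2]
  · have e : (insert k (S.erase j)).erase k = S.erase j :=
      Finset.erase_insert (by simp [h2])
    simp only [h1, h2, hjk, e, Finset.insert_erase h1, aux_ins]
    simp [hjk, ← aux_er j S, aux_sgn]
  · have e : (insert j (S.erase k)).erase j = S.erase k :=
      Finset.erase_insert (by simp [h1])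
    simp only [h1, h2, hjk, e, Finset.insert_erase h2, aux_ins]
    simp [hjk.symm, ← aux_er k S, aux_sgn]
  · simp [h1, h2]

lemma aux_count (ℓ : Fin n) (hℓ : (ℓ : ℕ) = n - 1) (S : Finset (Fin n)) :
    (∑ j : Fin n, ∑ k : Fin n, if j < k ∧ k ≠ ℓ then
      ((if j ∈ S ∧ k ∉ S then (1:ℂ) else 0) + (if k ∈ S ∧ j ∉ S then 1 else 0)) else 0)
    = ((S.erase ℓ).card : ℂ) * ((Sᶜ.erase ℓ).card : ℂ) := by
  have hmax : ∀ i : Fin n, i ≤ ℓ := fun i => by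
    rw [Fin.le_def]; omega
  have h1 : (∑ j : Fin n, ∑ k : Fin n, if j < k ∧ k ≠ ℓ then
      ((if j ∈ S ∧ k ∉ S then (1:ℂ) else 0) + (if k ∈ S ∧ j ∉ S then 1 else 0)) else 0)
      = (∑ j : Fin n, ∑ k : Fin n, if (j < k ∧ k ≠ ℓ) ∧ (j ∈ S ∧ k ∉ S) then (1:ℂ) else 0)
      + (∑ j : Fin n, ∑ k : Fin n, if (j < k ∧ k ≠ ℓ) ∧ (k ∈ S ∧ j ∉ S) then (1:ℂ) else 0) := by
    simp only [← Finset.sum_add_distrib]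
    refine Finset.sum_congr rfl fun j _ => Finset.sum_congr rfl fun k _ => ?_
    by_cases h : j < k ∧ k ≠ ℓ <;> simp [h]
  rw [h1, Finset.sum_comm (f := fun j k => if (j < k ∧ k ≠ ℓ) ∧ (k ∈ S ∧ j ∉ S) then (1:ℂ) else 0)]
  have c : ∀ T : Finset (Fin n), (T.card : ℂ) = ∑ j, if j ∈ T then (1:ℂ) else 0 := by
    intro T; simp
  rw [c, c, Finset.sum_mul_sum]
  simp only [← Finset.sum_add_distrib]
  refine Finset.sum_congr rfl fun j _ => Finset.sum_congr rfl fun k _ => ?_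
  have hj := hmax j
  have hk := hmax k
  simp only [Finset.mem_erase, Finset.mem_compl]
  by_cases a : j ∈ S <;> by_cases b : k ∈ S <;> simp only [a, b, not_true, not_false_iff, and_true, and_false, if_false, add_zero, mul_zero, zero_mul]
  have hne : j ≠ k := fun h => b (h ▸ a)
  rcases lt_or_gt_of_ne hne with h | h
  · have : j ≠ ℓ := (lt_of_lt_of_le h hk).ne
    simp [h, h.not_gt, this]
  · have : k ≠ ℓ := (lt_of_lt_of_le h hj).ne
    simp [h, h.not_gt, this]

/-- so(n-1)-Casimir identity on the exterior algebra:
Σ_{1 ≤ j < k ≤ n-1} L_{jk}² = -p(n-p-1) i_{e_n} ε_{e_n} - (p-1)(n-p) ε_{e_n} i_{e_n}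
on Λ^p ℂ^n, where ℓ is the index of e_n (the last basis vector). -/
theorem stmt18 (n p : ℕ) (hn : 2 ≤ n) (hp : p ≤ n)
    (ℓ : Fin n) (hℓ : (ℓ : ℕ) = n - 1)
    (v : Lam n) (hv : IsForm p v) :
    (∑ j : Fin n, ∑ k : Fin n,
        if j < k ∧ k ≠ ℓ then Ljk j k (Ljk j k v) else 0)
      = ((-((p:ℝ) * ((n:ℝ) - p - 1)) : ℝ) : ℂ) • iot (ee ℓ) (eps (ee ℓ) v)
        + ((-(((p:ℝ) - 1) * ((n:ℝ) - p)) : ℝ) : ℂ) • eps (ee ℓ) (iot (ee ℓ) v) := by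
  ext S
  have hL : (∑ j : Fin n, ∑ k : Fin n,
        if j < k ∧ k ≠ ℓ then Ljk j k (Ljk j k v) else 0) S
      = -(((S.erase ℓ).card : ℂ) * ((Sᶜ.erase ℓ).card : ℂ)) * v S := by
    rw [← aux_count ℓ hℓ S]
    simp only [WithLp.ofLp_sum, Finset.sum_apply, ← Finset.sum_neg_distrib, Finset.sum_mul]
    refine Finset.sum_congr rfl fun j _ => Finset.sum_congr rfl fun k _ => ?_
    by_cases h : j < k ∧ k ≠ ℓ
    · rw [if_pos h, if_pos h, aux_LL j k h.1.ne]
    · rw [if_neg h, if_neg h]; simp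
  rw [hL]
  simp only [PiLp.add_apply, PiLp.smul_apply, smul_eq_mul, aux_ie, aux_ei]
  by_cases hS : S.card = p
  · have hc : Sᶜ.card + p = n := by
      rw [← hS, add_comm, Finset.card_add_card_compl]; simp
    by_cases hm : ℓ ∈ S
    · have e1 : (S.erase ℓ).card + 1 = p := by rw [Finset.card_erase_add_one hm, hS]
      rw [Finset.erase_eq_of_notMem (by simpa using hm : ℓ ∉ Sᶜ)]
      have hn' : (n : ℂ) = (Sᶜ.card : ℂ) + p := by rw [← Nat.cast_add, hc]
      have hp' : (p : ℂ) = ((S.erase ℓ).card : ℂ) + 1 := by rw [← e1]; push_cast; rfl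
      rw [if_pos hm, if_pos hm]
      simp only [Complex.ofReal_neg, Complex.ofReal_mul, Complex.ofReal_sub, Complex.ofReal_natCast, Complex.ofReal_one]
      rw [hn', hp']
      ring
    · have e1 : (Sᶜ.erase ℓ).card + 1 = Sᶜ.card :=
        Finset.card_erase_add_one (by simpa using hm)
      rw [Finset.erase_eq_of_notMem hm, hS]
      have hn' : (n : ℂ) = ((Sᶜ.erase ℓ).card : ℂ) + 1 + p := by
        rw [← Nat.cast_add_one, e1, ← Nat.cast_add, hc]
      rw [if_neg hm, if_neg hm]
      simp only [Complex.ofReal_neg, Complex.ofReal_mul, Complex.ofReal_sub, Complex.ofReal_natCast, Complex.ofReal_one]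
      rw [hn']
      ring
  · simp [hv S hS]
end
end

section
/- (Conjugation of the hyperbolic form Laplacian into Δ_{a,p}.) Let n ≥ 2, 0 ≤ p ≤ n and a ∈ ℝ. For every smooth Λ^p ℂ^n-valued function u on the upper half space {x ∈ ℝ^n : x_n > 0} one has, at every point with x_n > 0, Δ_{2(p+1)−n, p}[ x_n^{(a+n−2p−2)/2} u ](x) = x_n^{(a+n−2p−2)/2} [ Δ_{a,p} u(x) + (1/4)(a + n − 2p − 2)(a − n + 2p) u(x) ]; here Δ_{2(p+1)−n, p} is the Laplace–Beltrami operator on p-forms of hyperbolic upper half space expressed in Euclidean terms. -/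
open MeasureTheory Complex Finset

noncomputable section

variable {n : ℕ}

lemma eps_smul' (z : Fin n → ℂ) (c : ℝ) (v : Lam n) : eps z (c • v) = c • eps z v := by
  ext S
  simp only [eps, PiLp.smul_apply, Finset.smul_sum, Complex.real_smul]
  exact Finset.sum_congr rfl fun j _ => by ring

lemma iot_smul' (z : Fin n → ℂ) (c : ℝ) (v : Lam n) : iot z (c • v) = c • iot z v := by
  ext S
  simp only [iot, PiLp.smul_apply, Finset.smul_sum, Complex.real_smul]
  exact Finset.sum_congr rfl fun j _ => by ring

lemma hasFDerivAt_rpow_coord (ℓ : Fin n) (s : ℝ) (y : Rn n) (hy : 0 < y ℓ) :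
    HasFDerivAt (fun y : Rn n => (y ℓ) ^ s)
      ((s * (y ℓ) ^ (s - 1)) • (EuclideanSpace.proj ℓ : Rn n →L[ℝ] ℝ)) y :=
  HasFDerivAt.rpow_const (f := fun y : Rn n => y ℓ)
    (EuclideanSpace.proj (𝕜 := ℝ) ℓ : Rn n →L[ℝ] ℝ).hasFDerivAt (Or.inl hy.ne')

lemma pd_rpow_smul (ℓ j : Fin n) (s : ℝ) (v : Rn n → Lam n) (y : Rn n) (hy : 0 < y ℓ)
    (hv : DifferentiableAt ℝ v y) :
    pd j (fun y => ((y ℓ) ^ s : ℝ) • v y) y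
      = ((y ℓ) ^ s : ℝ) • pd j v y + (if j = ℓ then s * (y ℓ) ^ (s - 1) else 0 : ℝ) • v y := by
  have h := ((hasFDerivAt_rpow_coord ℓ s y hy).smul hv.hasFDerivAt).fderiv
  unfold pd
  change fderiv ℝ ((fun y : Rn n => (y ℓ) ^ s) • v) y _ = _
  rw [h]
  by_cases hj : j = ℓ
  · subst hj; simp
  · have : ¬ ℓ = j := fun h => hj h.symm
    simp [hj, this]

lemma pd_congr (j : Fin n) {v w : Rn n → Lam n} {x : Rn n} (h : v =ᶠ[nhds x] w) :
    pd j v x = pd j w x := by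
  unfold pd; rw [h.fderiv_eq]

lemma pd_add' (j : Fin n) {v w : Rn n → Lam n} {x : Rn n} (hv : DifferentiableAt ℝ v x)
    (hw : DifferentiableAt ℝ w x) :
    pd j (fun y => v y + w y) x = pd j v x + pd j w x := by
  unfold pd; rw [fderiv_fun_add hv hw]; rfl

lemma pd_const_smul' (j : Fin n) (c : ℝ) {v : Rn n → Lam n} {x : Rn n}
    (hv : DifferentiableAt ℝ v x) :
    pd j (fun y => c • v y) x = c • pd j v x := by
  unfold pd; rw [fderiv_fun_const_smul hv]; rfl

lemma pd_pd_rpow_smul (ℓ j : Fin n) (s : ℝ) (u : Rn n → Lam n)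
    (hu : ContDiffOn ℝ (⊤ : ℕ∞) u {x : Rn n | 0 < x ℓ}) (x : Rn n) (hx : 0 < x ℓ) :
    pd j (pd j (fun y => ((y ℓ) ^ s : ℝ) • u y)) x
      = ((x ℓ) ^ s : ℝ) • pd j (pd j u) x + (if j = ℓ then
          ((2 * s * (x ℓ) ^ (s - 1)) • pd ℓ u x
            + (s * ((s - 1) * (x ℓ) ^ (s - 1 - 1))) • u x) else 0) := by
  have hopen : IsOpen {x : Rn n | 0 < x ℓ} :=
    isOpen_lt continuous_const (EuclideanSpace.proj (𝕜 := ℝ) ℓ : Rn n →L[ℝ] ℝ).continuous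
  have hd : ∀ y : Rn n, 0 < y ℓ → DifferentiableAt ℝ u y := fun y hy =>
    (hu.contDiffAt (hopen.mem_nhds hy)).differentiableAt (by simp)
  have hpd : DifferentiableAt ℝ (pd j u) x := by
    have h1 : ContDiffAt ℝ 1 (fderiv ℝ u) x :=
      (hu.contDiffAt (hopen.mem_nhds hx)).fderiv_right (by norm_cast)
    exact (h1.differentiableAt (by simp)).clm_apply (differentiableAt_const _)
  have hr : ∀ t : ℝ, DifferentiableAt ℝ (fun y : Rn n => (y ℓ) ^ t) x := fun t =>
    (hasFDerivAt_rpow_coord ℓ t x hx).differentiableAt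
  have hev : pd j (fun y => ((y ℓ) ^ s : ℝ) • u y) =ᶠ[nhds x] fun y =>
      ((y ℓ) ^ s : ℝ) • pd j u y
        + (if j = ℓ then s else 0 : ℝ) • (((y ℓ) ^ (s - 1) : ℝ) • u y) := by
    filter_upwards [hopen.mem_nhds hx] with y hy
    rw [pd_rpow_smul ℓ j s u y hy (hd y hy), smul_smul]
    congr 2
    split_ifs <;> simp
  have hA : DifferentiableAt ℝ (fun y : Rn n => ((y ℓ) ^ s : ℝ) • pd j u y) x := (hr s).smul hpd
  have hB : DifferentiableAt ℝ (fun y : Rn n => ((y ℓ) ^ (s - 1) : ℝ) • u y) x :=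
    (hr (s - 1)).smul (hd x hx)
  rw [pd_congr j hev, pd_add' j hA (hB.fun_const_smul _), pd_const_smul' j _ hB,
    pd_rpow_smul ℓ j s _ x hx hpd, pd_rpow_smul ℓ j (s - 1) u x hx (hd x hx)]
  by_cases hj : j = ℓ
  · subst hj
    simp only [if_true]
    module
  · simp [hj]

/-- conjugation of the hyperbolic form Laplacian into Δ_{a,p}: for u smooth
on the upper half space and x_n > 0,
Δ_{2(p+1)-n,p}[x_n^{(a+n-2p-2)/2} u](x)
  = x_n^{(a+n-2p-2)/2} [Δ_{a,p}u(x) + (1/4)(a+n-2p-2)(a-n+2p)u(x)],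
where Δ_{2(p+1)-n,p} is the Laplace–Beltrami operator on p-forms of hyperbolic upper half
space expressed in Euclidean terms, and ℓ is the index of the last coordinate. -/
theorem stmt19 (n p : ℕ) (hn : 2 ≤ n) (hp : p ≤ n) (a : ℝ)
    (ℓ : Fin n) (hℓ : (ℓ : ℕ) = n - 1)
    (u : Rn n → Lam n)
    (hu : ContDiffOn ℝ (⊤ : ℕ∞) u {x : Rn n | 0 < x ℓ})
    (x : Rn n) (hx : 0 < x ℓ) :
    Dap (2*((p:ℝ)+1) - n) p ℓ
        (fun y => ((y ℓ) ^ ((a + (n:ℝ) - 2*p - 2)/2) : ℝ) • u y) x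
      = ((x ℓ) ^ ((a + (n:ℝ) - 2*p - 2)/2) : ℝ) •
          (Dap a p ℓ u x
            + ((1/4 * (a + (n:ℝ) - 2*p - 2) * (a - (n:ℝ) + 2*p)) : ℝ) • u x) := by
  have hopen : IsOpen {x : Rn n | 0 < x ℓ} :=
    isOpen_lt continuous_const (EuclideanSpace.proj (𝕜 := ℝ) ℓ : Rn n →L[ℝ] ℝ).continuous
  have hd : DifferentiableAt ℝ u x :=
    (hu.contDiffAt (hopen.mem_nhds hx)).differentiableAt (by simp)
  obtain ⟨s, hs⟩ : ∃ s : ℝ, s = (a + (n:ℝ) - 2*p - 2)/2 := ⟨_, rfl⟩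
  have ha : a = 2 * s - n + 2 * p + 2 := by rw [hs]; ring
  rw [← hs]
  have h1 : ∀ j ∈ univ.erase ℓ, pd j (fun y => ((y ℓ) ^ s : ℝ) • u y) x
      = ((x ℓ) ^ s : ℝ) • pd j u x := fun j hj => by
    rw [pd_rpow_smul ℓ j s u x hx hd, if_neg (Finset.ne_of_mem_erase hj)]; simp
  have e1 : ∑ j ∈ univ.erase ℓ, eps (ee j) (pd j (fun y => ((y ℓ) ^ s : ℝ) • u y) x)
      = ((x ℓ) ^ s : ℝ) • ∑ j ∈ univ.erase ℓ, eps (ee j) (pd j u x) := by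
    rw [Finset.smul_sum]
    exact Finset.sum_congr rfl fun j hj => by rw [h1 j hj, eps_smul']
  have e2 : ∑ j ∈ univ.erase ℓ, iot (ee j) (pd j (fun y => ((y ℓ) ^ s : ℝ) • u y) x)
      = ((x ℓ) ^ s : ℝ) • ∑ j ∈ univ.erase ℓ, iot (ee j) (pd j u x) := by
    rw [Finset.smul_sum]
    exact Finset.sum_congr rfl fun j hj => by rw [h1 j hj, iot_smul']
  have e3 : ∑ j, pd j (pd j (fun y => ((y ℓ) ^ s : ℝ) • u y)) x
      = ((x ℓ) ^ s : ℝ) • ∑ j, pd j (pd j u) x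
        + ((2 * s * (x ℓ) ^ (s - 1)) • pd ℓ u x
            + (s * ((s - 1) * (x ℓ) ^ (s - 1 - 1))) • u x) := by
    rw [Finset.sum_congr rfl fun j _ => pd_pd_rpow_smul ℓ j s u hu x hx,
      Finset.sum_add_distrib, Finset.smul_sum]
    simp
  unfold Dap
  rw [e1, e2, e3, pd_rpow_smul ℓ ℓ s u x hx hd, ← smul_neg]
  simp only [iot_smul', eps_smul', if_true]
  have r1 : (x ℓ) ^ s = (x ℓ) ^ (s - 1 - 1) * (x ℓ * x ℓ) := by
    rw [← mul_assoc, ← Real.rpow_add_one hx.ne', ← Real.rpow_add_one hx.ne']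
    congr 1; ring
  have r2 : (x ℓ) ^ (s - 1) = (x ℓ) ^ (s - 1 - 1) * x ℓ := by
    rw [← Real.rpow_add_one hx.ne']
    congr 1; ring
  rw [r1, r2, ha]
  module
end
end
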